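/- Let c ∈ ℭ_+(N), m_1, …, m_n ∈ ℂ, and λ > 0. Define the regularized functional J_λ(P,Q) := J(P,Q) − (λ/(2N)) Σ_{j=-N+1}^{N} log P(ζ_j). Then J_λ attains a minimum over 𝔓°_+(N) × 𝔓_+(N) at some (P̂, Q̂) (with P̂ in the interior 𝔓_+(N)), and any minimizer (P̂, Q̂) satisfies: the function Φ̂(ζ_j) := P̂(ζ_j)/Q̂(ζ_j) satisfies the covariance moment conditions (1/(2N)) Σ_j ζ_j^k Φ̂(ζ_j) = c_k for k = 0, …, n, and the adjusted logarithmic moment conditions (1/(2N)) Σ_j ζ_j^k log Φ̂(ζ_j) = m_k + ε_k for k = 1, …, n, where ε_k := (λ/(2N)) Σ_{j=-N+1}^{N} ζ_j^k / P̂(ζ_j). -/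

import Mathlib

open Complex Finset Filter Topology

noncomputable section

/-- Coefficient space for symmetric trigonometric polynomials of degree `n`:
`(p₀, (p₁, …, pₙ))` with `p₀` real and `p₋ₖ = conj pₖ` implicit. Also used for
covariance data `c = (c₀, (c₁, …, cₙ))`. -/
abbrev Coef (n : ℕ) := ℝ × (Fin n → ℂ)

/-- The `2N`-th roots of unity `ζ_j = exp(iπj/N)`. -/
def zet (N : ℕ) (j : ℤ) : ℂ := Complex.exp (Real.pi * Complex.I * j / N)

/-- The index set `j = -N+1, …, N`. -/
def idxs (N : ℕ) : Finset ℤ := Finset.Icc (-(N : ℤ) + 1) N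

/-- Evaluation of `P(z) = Σ_{k=-n}^n p_k z^{-k}` (with `p₋ₖ = conj pₖ`). -/
def evalC {n : ℕ} (p : Coef n) (z : ℂ) : ℂ :=
  (p.1 : ℂ) + ∑ k : Fin n,
    (p.2 k * z⁻¹ ^ ((k : ℕ) + 1) + (starRingEnd ℂ) (p.2 k) * z ^ ((k : ℕ) + 1))

/-- Real value of the symmetric trigonometric polynomial on the unit circle. -/
def evalR {n : ℕ} (p : Coef n) (z : ℂ) : ℝ := (evalC p z).re

/-- The open cone `𝔓₊(N)`. -/
def Pplus (n N : ℕ) : Set (Coef n) := {p | ∀ j ∈ idxs N, 0 < evalR p (zet N j)}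

/-- The closure of `𝔓₊(N)`: `P(ζ_j) ≥ 0` for all `j`. -/
def Pnn (n N : ℕ) : Set (Coef n) := {p | ∀ j ∈ idxs N, 0 ≤ evalR p (zet N j)}

/-- The cone `𝔓₊` of trigonometric polynomials positive on the whole circle. -/
def PplusC (n : ℕ) : Set (Coef n) :=
  {p | ∀ θ ∈ Set.Icc (-Real.pi) Real.pi, 0 < evalR p (Complex.exp (θ * Complex.I))}

/-- The closure of `𝔓₊`: nonnegative on the whole circle. -/
def PnnC (n : ℕ) : Set (Coef n) :=
  {p | ∀ θ ∈ Set.Icc (-Real.pi) Real.pi, 0 ≤ evalR p (Complex.exp (θ * Complex.I))}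

/-- The pairing `⟨C,P⟩ = Σ_{k=-n}^n c_k conj(p_k)` (a real number). -/
def pairCP {n : ℕ} (c p : Coef n) : ℝ :=
  c.1 * p.1 + ∑ k : Fin n, 2 * (c.2 k * (starRingEnd ℂ) (p.2 k)).re

/-- The open dual cone `ℭ₊(N)`. -/
def Cplus (n N : ℕ) : Set (Coef n) := {c | ∀ p ∈ Pnn n N, p ≠ 0 → 0 < pairCP c p}

/-- The open dual cone `ℭ₊`. -/
def CplusC (n : ℕ) : Set (Coef n) := {c | ∀ p ∈ PnnC n, p ≠ 0 → 0 < pairCP c p}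

/-- The discrete moment `(1/(2N)) Σ_j ζ_j^k Φ(ζ_j)`. -/
def dmom (N : ℕ) (Φ : ℤ → ℝ) (k : ℤ) : ℂ :=
  (1 / (2 * (N : ℂ))) * ∑ j ∈ idxs N, zet N j ^ k * (Φ j : ℂ)

/-- `Φ` (a function of the index `j`) satisfies the moment conditions for `c`. -/
def MomCond {n : ℕ} (N : ℕ) (c : Coef n) (Φ : ℤ → ℝ) : Prop :=
  dmom N Φ 0 = (c.1 : ℂ) ∧ ∀ k : Fin n, dmom N Φ ((k : ℕ) + 1) = c.2 k

/-- The function `j ↦ P(ζ_j)/Q(ζ_j)`. -/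
def phiOf {n : ℕ} (N : ℕ) (P Q : Coef n) : ℤ → ℝ :=
  fun j => evalR P (zet N j) / evalR Q (zet N j)

/-- The dual functional `J_P(Q) = ⟨C,Q⟩ − (1/(2N)) Σ_j P(ζ_j) log Q(ζ_j)`. -/
def JP {n : ℕ} (N : ℕ) (c P Q : Coef n) : ℝ :=
  pairCP c Q - (1 / (2 * (N : ℝ))) * ∑ j ∈ idxs N,
    evalR P (zet N j) * Real.log (evalR Q (zet N j))

/-- The moment map `F^P`, with components `F^P_k(Q) = (1/(2N)) Σ_j ζ_j^k P(ζ_j)/Q(ζ_j)`. -/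
def Fmap {n : ℕ} (N : ℕ) (P Q : Coef n) : Coef n :=
  ((dmom N (phiOf N P Q) 0).re, fun k => dmom N (phiOf N P Q) ((k : ℕ) + 1))

/-- The real-valued functional
`J(P,Q) = ⟨C,Q⟩ − ⟨M,P⟩ + (1/(2N)) Σ_j P(ζ_j) log(P(ζ_j)/Q(ζ_j))` on the open domain. -/
def Jfun {n : ℕ} (N : ℕ) (c : Coef n) (m : Fin n → ℂ) (P Q : Coef n) : ℝ :=
  pairCP c Q - pairCP ((0 : ℝ), m) P + (1 / (2 * (N : ℝ))) *
    ∑ j ∈ idxs N, evalR P (zet N j) * Real.log (evalR P (zet N j) / evalR Q (zet N j))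

/-- The open domain `𝔓°₊(N) × 𝔓₊(N)`. -/
def DomOp (n N : ℕ) : Set (Coef n × Coef n) :=
  {PQ | PQ.1 ∈ Pplus n N ∧ PQ.1.1 = 1 ∧ PQ.2 ∈ Pplus n N}

/-- The discrete logarithmic moment `(1/(2N)) Σ_j ζ_j^k log Φ(ζ_j)`. -/
def lmom (N : ℕ) (Φ : ℤ → ℝ) (k : ℤ) : ℂ :=
  (1 / (2 * (N : ℂ))) * ∑ j ∈ idxs N, zet N j ^ k * ((Real.log (Φ j) : ℝ) : ℂ)

/-- The regularized functional `J_λ(P,Q) = J(P,Q) − (λ/(2N)) Σ_j log P(ζ_j)`. -/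
def Jlam {n : ℕ} (N : ℕ) (c : Coef n) (m : Fin n → ℂ) (lam : ℝ) (P Q : Coef n) : ℝ :=
  Jfun N c m P Q - (lam / (2 * (N : ℝ))) * ∑ j ∈ idxs N, Real.log (evalR P (zet N j))


/-! ### Roots of unity -/

lemma norm_zet (N : ℕ) (j : ℤ) : ‖zet N j‖ = 1 := by
  have h : (Real.pi * Complex.I * j / N : ℂ) = ((Real.pi * j / N : ℝ) : ℂ) * Complex.I := by
    push_cast; ring
  rw [zet, h, Complex.norm_exp_ofReal_mul_I]

lemma zet_ne_zero (N : ℕ) (j : ℤ) : zet N j ≠ 0 := Complex.exp_ne_zero _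

lemma card_idxs (N : ℕ) : ((idxs N).card : ℝ) = 2 * N := by
  have : (idxs N).card = 2 * N := by simp only [idxs, Int.card_Icc]; omega
  rw [this]; push_cast; ring

/-- Discrete orthogonality of the characters on the `2N`-th roots of unity. -/
lemma sum_zet_zpow {N : ℕ} (hN : 0 < N) {a : ℤ} (ha : ¬ (2 * N : ℤ) ∣ a) :
    ∑ j ∈ idxs N, zet N j ^ a = 0 := by
  have hω := Complex.isPrimitiveRoot_exp (2 * N) (by omega)
  set ω := Complex.exp (2 * Real.pi * Complex.I / ((2 * N : ℕ) : ℂ)) with hωd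
  have hN' : (N : ℂ) ≠ 0 := by exact_mod_cast hN.ne'
  have hz : ∀ j : ℤ, zet N j = ω ^ j := by
    intro j
    rw [hωd, ← Complex.exp_int_mul, zet]
    congr 1
    push_cast
    field_simp
  have hω0 : ω ≠ 0 := Complex.exp_ne_zero _
  set x := ω ^ a with hx
  have hx0 : x ≠ 0 := zpow_ne_zero _ hω0
  have hx1 : x ≠ 1 := fun h => ha (by
    have := (hω.zpow_eq_one_iff_dvd a).1 h
    exact_mod_cast this)
  have hxN : x ^ (2 * N) = 1 := by
    rw [hx, ← zpow_natCast, ← zpow_mul, mul_comm, zpow_mul, zpow_natCast, hω.pow_eq_one, one_zpow]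
  have hzx : ∀ j : ℤ, zet N j ^ a = x ^ j := by
    intro j
    rw [hz, hx, ← zpow_mul, ← zpow_mul, mul_comm]
  have hre : ∑ j ∈ idxs N, zet N j ^ a
      = ∑ i ∈ Finset.range (2 * N), x ^ (-(N : ℤ) + 1) * x ^ i := by
    symm
    refine Finset.sum_nbij' (fun i : ℕ => -(N : ℤ) + 1 + i) (fun j => (j + N - 1).toNat)
      ?_ ?_ ?_ ?_ ?_
    · intro i hi
      simp only [Finset.mem_range, idxs, Finset.mem_Icc] at *
      omega
    · intro i hi
      simp only [Finset.mem_range, idxs, Finset.mem_Icc] at *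
      omega
    · intro i hi
      simp only [Finset.mem_range] at *
      omega
    · intro i hi
      simp only [idxs, Finset.mem_Icc] at *
      omega
    · intro i hi
      rw [hzx, zpow_add₀ hx0 _ (i : ℤ), zpow_natCast]
  rw [hre, ← Finset.mul_sum, geom_sum_eq hx1, hxN]
  simp

lemma sum_zet_pow {n N : ℕ} (hnN : n < N) (k : Fin n) :
    ∑ j ∈ idxs N, zet N j ^ ((k : ℕ) + 1) = 0 := by
  have h := sum_zet_zpow (N := N) (by omega) (a := (((k : ℕ) + 1 : ℕ) : ℤ)) (by
    intro h
    have := Int.le_of_dvd (by positivity) h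
    omega)
  simpa only [zpow_natCast] using h

/-! ### Evaluation and pairing -/

lemma evalC_eq_evalR {n : ℕ} (p : Coef n) {z : ℂ} (hz : ‖z‖ = 1) :
    evalC p z = (evalR p z : ℂ) := by
  symm
  rw [evalR, ← Complex.conj_eq_iff_re, evalC]
  simp only [map_add, map_sum, map_mul, map_pow, Complex.conj_ofReal, Complex.conj_conj,
    Complex.inv_eq_conj hz]
  congr 1
  exact Finset.sum_congr rfl fun k _ => add_comm _ _

lemma evalR_eq_pairCP {n : ℕ} (p : Coef n) {z : ℂ} (hz : ‖z‖ = 1) :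
    evalR p z = pairCP ((1 : ℝ), fun k : Fin n => z ^ ((k : ℕ) + 1)) p := by
  simp only [evalR, evalC, pairCP, Complex.add_re, Complex.re_sum, Complex.ofReal_re, one_mul,
    Complex.inv_eq_conj hz]
  congr 1
  refine Finset.sum_congr rfl fun k _ => ?_
  rw [← map_pow, ← Complex.conj_re (p.2 k * _)]
  simp only [map_mul, Complex.conj_conj, mul_comm (z ^ _)]
  ring

lemma pairCP_add_smul_right {n : ℕ} (c p h : Coef n) (t : ℝ) :
    pairCP c (p + t • h) = pairCP c p + t * pairCP c h := by
  simp only [pairCP, Prod.fst_add, Prod.snd_add, Prod.smul_fst, Prod.smul_snd, Pi.add_apply,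
    Pi.smul_apply, smul_eq_mul, mul_add, Finset.mul_sum]
  rw [add_add_add_comm, ← Finset.sum_add_distrib]
  congr 1
  · ring
  · refine Finset.sum_congr rfl fun k _ => ?_
    simp
    ring

lemma evalR_add_smul {n : ℕ} (p h : Coef n) (t : ℝ) {z : ℂ} (hz : ‖z‖ = 1) :
    evalR (p + t • h) z = evalR p z + t * evalR h z := by
  simp only [evalR_eq_pairCP _ hz, pairCP_add_smul_right]

lemma pairCP_comm {n : ℕ} (c p : Coef n) : pairCP c p = pairCP p c := by
  simp only [pairCP]
  congr 1
  · ring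
  · refine Finset.sum_congr rfl fun k _ => ?_
    simp
    ring

lemma pairCP_zero_right {n : ℕ} (c : Coef n) : pairCP c 0 = 0 := by simp [pairCP]

lemma pairCP_smul_right {n : ℕ} (c h : Coef n) (t : ℝ) :
    pairCP c (t • h) = t * pairCP c h := by
  simpa [pairCP_zero_right] using pairCP_add_smul_right c 0 h t

lemma pairCP_sub_left {n : ℕ} (c d p : Coef n) :
    pairCP (c - d) p = pairCP c p - pairCP d p := by
  have := pairCP_add_smul_right p c d (-1)
  rw [neg_one_smul, ← sub_eq_add_neg] at this
  rw [pairCP_comm, this, pairCP_comm c, pairCP_comm d]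
  ring

lemma sum_smul_evalR {n : ℕ} (N : ℕ) (w : ℤ → ℝ) (p : Coef n) :
    ∑ j ∈ idxs N, w j * evalR p (zet N j) =
      pairCP (∑ j ∈ idxs N, w j • (((1 : ℝ), fun k : Fin n => zet N j ^ ((k : ℕ) + 1)) : Coef n))
        p := by
  rw [pairCP_comm]
  induction idxs N using Finset.induction_on with
  | empty => simp [pairCP_zero_right]
  | insert a s ha ih =>
    rw [Finset.sum_insert ha, Finset.sum_insert ha, ih, add_comm (w a • _),
      pairCP_add_smul_right, evalR_eq_pairCP _ (norm_zet N a), pairCP_comm p (1, _), add_comm]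

/-- The weighted moments of `w`, as the coefficient vector representing
`p ↦ (1/(2N)) Σ_j w_j p(ζ_j)` through `pairCP`. -/
def momVec (n N : ℕ) (w : ℤ → ℝ) : Coef n :=
  ((1 / (2 * (N : ℝ))) * ∑ j ∈ idxs N, w j, fun k => dmom N w ((k : ℕ) + 1))

lemma momVec_pairCP {n : ℕ} (N : ℕ) (w : ℤ → ℝ) (p : Coef n) :
    pairCP (momVec n N w) p =
      (1 / (2 * (N : ℝ))) * ∑ j ∈ idxs N, w j * evalR p (zet N j) := by
  rw [sum_smul_evalR, pairCP_comm _ p, pairCP_comm _ p, ← pairCP_smul_right]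
  congr 1
  refine Prod.ext ?_ (funext fun k => ?_)
  · simp [momVec, Prod.fst_sum]
  · simp only [momVec, dmom, Prod.smul_snd, Prod.snd_sum, Finset.sum_apply, Pi.smul_apply,
      Complex.real_smul]
    push_cast
    congr 1
    refine Finset.sum_congr rfl fun j _ => ?_
    rw [mul_comm]
    norm_cast

lemma pairCP_self_eq_zero {n : ℕ} {d : Coef n} (h : pairCP d d = 0) : d = 0 := by
  have h1 : pairCP d d = d.1 * d.1 + ∑ k : Fin n, 2 * Complex.normSq (d.2 k) := by
    simp [pairCP, Complex.mul_conj]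
  rw [h1] at h
  have hs : 0 ≤ ∑ k : Fin n, 2 * Complex.normSq (d.2 k) :=
    Finset.sum_nonneg fun k _ => mul_nonneg zero_le_two (Complex.normSq_nonneg _)
  have h0 := mul_self_nonneg d.1
  have h2 : ∑ k : Fin n, 2 * Complex.normSq (d.2 k) = 0 := by linarith
  rw [Finset.sum_eq_zero_iff_of_nonneg
    fun k _ => mul_nonneg zero_le_two (Complex.normSq_nonneg _)] at h2
  refine Prod.ext (mul_self_eq_zero.1 (by linarith)) (funext fun k => ?_)
  simpa using h2 k (Finset.mem_univ k)

lemma sum_evalR {n N : ℕ} (hnN : n < N) (p : Coef n) :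
    ∑ j ∈ idxs N, evalR p (zet N j) = 2 * N * p.1 := by
  have h := momVec_pairCP N (fun _ => 1) p
  have hN : (N : ℝ) ≠ 0 := by exact_mod_cast (by omega : N ≠ 0)
  have h2 : momVec n N (fun _ => 1) = ((1 : ℝ), 0) := by
    refine Prod.ext ?_ (funext fun k => ?_)
    · simp only [momVec, Finset.sum_const, nsmul_eq_mul, card_idxs]
      field_simp
    · have := sum_zet_pow hnN k
      simp only [momVec, dmom, Complex.ofReal_one, mul_one]
      norm_cast
      simp [this]
  rw [h2] at h
  simp [pairCP] at h
  field_simp at h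
  linarith

/-- Recovery of the coefficients from the values at the nodes. -/
lemma sum_zet_mul_evalR {n N : ℕ} (hnN : n < N) (p : Coef n) (k : Fin n) :
    ∑ j ∈ idxs N, zet N j ^ ((k : ℕ) + 1) * (evalR p (zet N j) : ℂ) = 2 * N * p.2 k := by
  have hN : 0 < N := by omega
  simp only [← evalC_eq_evalR p (norm_zet N _), evalC, mul_add, Finset.mul_sum,
    Finset.sum_add_distrib]
  rw [← Finset.sum_mul, sum_zet_pow hnN k, zero_mul, zero_add, Finset.sum_comm,
    Finset.sum_comm (s := idxs N)]
  have h1 : ∀ l : Fin n, ∑ j ∈ idxs N, zet N j ^ ((k : ℕ) + 1) *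
      (p.2 l * (zet N j)⁻¹ ^ ((l : ℕ) + 1)) = if l = k then 2 * N * p.2 k else 0 := by
    intro l
    have e : ∀ j, zet N j ^ ((k : ℕ) + 1) * (p.2 l * (zet N j)⁻¹ ^ ((l : ℕ) + 1))
        = p.2 l * zet N j ^ ((k : ℤ) - l) := by
      intro j
      rw [show ((k : ℤ) - l) = (((k : ℕ) + 1 : ℕ) : ℤ) - (((l : ℕ) + 1 : ℕ) : ℤ) by
        push_cast; ring, zpow_sub₀ (zet_ne_zero N j), zpow_natCast, zpow_natCast, inv_pow]
      ring
    simp only [e, ← Finset.mul_sum]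
    split_ifs with h
    · subst h
      have hc : ((idxs N).card : ℂ) = 2 * N := by exact_mod_cast card_idxs N
      simp [hc]
      ring
    · rw [sum_zet_zpow hN, mul_zero]
      intro hd
      have h3 : (k : ℤ) - l ≠ 0 := fun h4 => h (Fin.ext (by omega))
      have := Int.le_of_dvd (abs_pos.2 h3) ((dvd_abs _ _).2 hd)
      have := abs_lt.2 (⟨by omega, by omega⟩ : -(2 * N : ℤ) < (k : ℤ) - l ∧ _ < (2 * N : ℤ))
      omega
  have h2 : ∀ l : Fin n, ∑ j ∈ idxs N, zet N j ^ ((k : ℕ) + 1) *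
      ((starRingEnd ℂ) (p.2 l) * zet N j ^ ((l : ℕ) + 1)) = 0 := by
    intro l
    have e : ∀ j, zet N j ^ ((k : ℕ) + 1) * ((starRingEnd ℂ) (p.2 l) * zet N j ^ ((l : ℕ) + 1))
        = (starRingEnd ℂ) (p.2 l) * zet N j ^ (((k : ℕ) + 1 + ((l : ℕ) + 1) : ℕ) : ℤ) := by
      intro j
      rw [zpow_natCast, pow_add]
      ring
    simp only [e, ← Finset.mul_sum]
    rw [sum_zet_zpow hN, mul_zero]
    intro hd
    have := Int.le_of_dvd (by positivity) hd
    omega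
  simp only [h1, h2, Finset.sum_const_zero, add_zero, Finset.sum_ite_eq',
    Finset.mem_univ, if_true]

lemma continuous_evalR {n : ℕ} (z : ℂ) : Continuous fun p : Coef n => evalR p z := by
  unfold evalR evalC
  fun_prop

lemma continuous_pairCP {n : ℕ} (c : Coef n) : Continuous fun p : Coef n => pairCP c p := by
  unfold pairCP
  fun_prop

lemma isCompact_evalR_Icc {n N : ℕ} (hnN : n < N) (a b : ℝ) :
    IsCompact {p : Coef n | ∀ j ∈ idxs N, evalR p (zet N j) ∈ Set.Icc a b} := by
  refine Metric.isCompact_of_isClosed_isBounded ?_ ?_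
  · simp only [Set.ofPred_forall]
    exact isClosed_biInter fun j _ => isClosed_Icc.preimage (continuous_evalR _)
  · refine isBounded_iff_forall_norm_le.2 ⟨|a| + |b|, fun p hp => ?_⟩
    have hN : (0 : ℝ) < 2 * N := by
      have : (0 : ℝ) < N := by exact_mod_cast (by omega : 0 < N)
      linarith
    have hb : ∀ j ∈ idxs N, |evalR p (zet N j)| ≤ |a| + |b| := fun j hj => by
      obtain ⟨h1, h2⟩ := hp j hj
      rw [abs_le]
      constructor <;> linarith [neg_abs_le a, le_abs_self b, abs_nonneg a, abs_nonneg b]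
    refine norm_prod_le_iff.2 ⟨?_, (pi_norm_le_iff_of_nonneg (by positivity)).2 fun k => ?_⟩
    · have := Finset.abs_sum_le_sum_abs (fun j => evalR p (zet N j)) (idxs N)
      have h3 := Finset.sum_le_card_nsmul _ _ _ hb
      rw [sum_evalR hnN, abs_mul, abs_of_pos hN] at this
      rw [nsmul_eq_mul, card_idxs] at h3
      exact le_of_mul_le_mul_left (this.trans h3) hN
    · have := norm_sum_le (idxs N)
        (fun j => zet N j ^ ((k : ℕ) + 1) * (evalR p (zet N j) : ℂ))
      simp only [norm_mul, norm_pow, norm_zet, one_pow, one_mul, Complex.norm_real,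
        Real.norm_eq_abs] at this
      have h3 := Finset.sum_le_card_nsmul _ _ _ hb
      rw [nsmul_eq_mul, card_idxs] at h3
      rw [sum_zet_mul_evalR hnN] at this
      simp only [norm_mul, Complex.norm_natCast, Complex.norm_ofNat] at this
      exact le_of_mul_le_mul_left (this.trans h3) hN

/-! ### Scalar estimates and derivatives -/

lemma scalar_lower_bound {ε : ℝ} (hε : 0 < ε) {B : ℝ} :
    ∃ A : ℝ, ∀ p q : ℝ, 0 < p → p ≤ B → 0 < q →
      ε / 2 * q - A ≤ ε * q + p * Real.log (p / q) := by
  refine ⟨B * |Real.log (ε / 2)|, fun p q hp hpB hq => ?_⟩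
  have h1 := Real.log_le_sub_one_of_pos (show 0 < ε / 2 * (q / p) by positivity)
  rw [Real.log_mul (by positivity) (by positivity), Real.log_div hq.ne' hp.ne'] at h1
  rw [Real.log_div hp.ne' hq.ne']
  have h2 := mul_le_mul_of_nonneg_left h1 hp.le
  have h3 : p * (ε / 2 * (q / p) - 1) = ε / 2 * q - p := by field_simp
  have h4 : p * -Real.log (ε / 2) ≤ B * |Real.log (ε / 2)| :=
    (mul_le_mul_of_nonneg_left (neg_le_abs _) hp.le).trans
      (mul_le_mul_of_nonneg_right hpB (abs_nonneg _))
  rw [h3] at h2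
  linarith

lemma hasDerivAt_log_div_right {a b : ℝ} (ha : 0 < a) (hb : 0 < b) (e : ℝ) :
    HasDerivAt (fun t : ℝ => a * Real.log (a / (b + t * e))) (-(a / b * e)) 0 := by
  have h : HasDerivAt (fun t : ℝ => b + t * e) e 0 := by
    simpa using ((hasDerivAt_id (0 : ℝ)).mul_const e).const_add b
  have h2 := (((hasDerivAt_const (0 : ℝ) a).fun_div h (by simpa using hb.ne')).log
    (by simp [ha.ne', hb.ne'])).const_mul a
  refine h2.congr_deriv ?_
  simp
  field_simp

lemma hasDerivAt_log_affine {a : ℝ} (ha : 0 < a) (e : ℝ) :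
    HasDerivAt (fun t : ℝ => Real.log (a + t * e)) (1 / a * e) 0 := by
  have h : HasDerivAt (fun t : ℝ => a + t * e) e 0 := by
    simpa using ((hasDerivAt_id (0 : ℝ)).mul_const e).const_add a
  refine (h.log (by simpa using ha.ne')).congr_deriv ?_
  simp
  ring

lemma hasDerivAt_mul_log_div {a b : ℝ} (ha : 0 < a) (hb : 0 < b) (e : ℝ) :
    HasDerivAt (fun t : ℝ => (a + t * e) * Real.log ((a + t * e) / b))
      ((Real.log (a / b) + 1) * e) 0 := by
  have h : HasDerivAt (fun t : ℝ => a + t * e) e 0 := by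
    simpa using ((hasDerivAt_id (0 : ℝ)).mul_const e).const_add a
  refine (h.fun_mul ((h.div_const b).log (by simp [ha.ne', hb.ne']))).congr_deriv ?_
  simp
  field_simp

lemma scalar_coercive {ε : ℝ} (hε : 0 < ε) {lam : ℝ} (hlam : 0 < lam) (B : ℝ) :
    ∃ L : ℝ, ∀ R : ℝ, ∃ δ > 0, ∃ b : ℝ, ∀ p q : ℝ, 0 < p → p ≤ B → 0 < q →
      -L ≤ ε * q + p * Real.log (p / q) - lam * Real.log p ∧
      (ε * q + p * Real.log (p / q) - lam * Real.log p ≤ R → δ ≤ p ∧ δ ≤ q ∧ q ≤ b) := by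
  obtain ⟨A, hA⟩ := scalar_lower_bound hε (B := B)
  refine ⟨A + lam * Real.log B, fun R => ?_⟩
  set d := Real.exp (-(R + A) / lam) with hd
  set K := |R| + lam * |Real.log B| with hK
  have hd0 : 0 < d := Real.exp_pos _
  have hK0 : 0 ≤ K := by positivity
  refine ⟨d * Real.exp (-(K / d)), by positivity, 2 / ε * (R + A + lam * Real.log B),
    fun p q hp hpB hq => ?_⟩
  have h := hA p q hp hpB hq
  have hlog := mul_le_mul_of_nonneg_left (Real.log_le_log hp hpB) hlam.le
  have hεq : 0 < ε / 2 * q := by positivity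
  refine ⟨by linarith, fun hR => ?_⟩
  have hdp : d ≤ p := by
    rw [hd, ← Real.le_log_iff_exp_le hp, div_le_iff₀ hlam]
    linarith
  have hexp : Real.exp (-(K / d)) ≤ 1 := Real.exp_le_one_iff.2 (by
    have : 0 ≤ K / d := by positivity
    linarith)
  refine ⟨(mul_le_of_le_one_right hd0.le hexp).trans hdp, ?_, ?_⟩
  · have hlogB := mul_le_mul_of_nonneg_left (le_abs_self (Real.log B)) hlam.le
    have h1 : p * Real.log (p / q) ≤ K := by
      have := le_abs_self R
      have : 0 < ε * q := by positivity
      linarith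
    have h2 : Real.log (p / q) ≤ K / d := by
      rw [mul_comm, ← le_div_iff₀ hp] at h1
      exact h1.trans (by gcongr)
    rw [Real.log_le_iff_le_exp (by positivity), div_le_iff₀ hq] at h2
    calc d * Real.exp (-(K / d)) ≤ (Real.exp (K / d) * q) * Real.exp (-(K / d)) := by
          gcongr
          exact hdp.trans h2
      _ = q := by rw [mul_right_comm, ← Real.exp_add]; simp
  · have h5 : ε / 2 * q ≤ R + A + lam * Real.log B := by linarith
    calc q = 2 / ε * (ε / 2 * q) := by field_simp
      _ ≤ _ := by gcongr

/-! ### Existence of a minimizer -/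

lemma le_of_mem_Pnn {n N : ℕ} (hnN : n < N) {p : Coef n} (hp : p ∈ Pnn n N) {j : ℤ}
    (hj : j ∈ idxs N) : evalR p (zet N j) ≤ 2 * N * p.1 :=
  sum_evalR hnN p ▸ Finset.single_le_sum (f := fun j => evalR p (zet N j)) hp hj

lemma fst_nonneg_of_mem_Pnn {n N : ℕ} (hnN : n < N) {p : Coef n} (hp : p ∈ Pnn n N) :
    0 ≤ p.1 := by
  have h := sum_evalR hnN p ▸ Finset.sum_nonneg hp
  have hN : (0 : ℝ) < 2 * N := by
    have : (0 : ℝ) < N := by exact_mod_cast (by omega : 0 < N)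
    linarith
  exact nonneg_of_mul_nonneg_right h hN

lemma isCompact_Pnn_normalized {n N : ℕ} (hnN : n < N) :
    IsCompact {p : Coef n | p ∈ Pnn n N ∧ p.1 = 1} := by
  have h := (isCompact_evalR_Icc (n := n) hnN 0 (2 * N)).inter_right
    (isClosed_singleton.preimage continuous_fst : IsClosed (Prod.fst ⁻¹' {(1 : ℝ)} : Set (Coef n)))
  convert h using 1
  ext p
  constructor
  · rintro ⟨h1, h2⟩
    exact ⟨fun j hj => ⟨h1 j hj, by simpa [h2] using le_of_mem_Pnn hnN h1 hj⟩, h2⟩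
  · rintro ⟨h1, h2⟩
    exact ⟨fun j hj => (h1 j hj).1, h2⟩

lemma evalR_one {n : ℕ} (z : ℂ) : evalR (((1 : ℝ), 0) : Coef n) z = 1 := by
  simp [evalR, evalC]

lemma evalR_smul {n : ℕ} (N : ℕ) (j : ℤ) (t : ℝ) (p : Coef n) :
    evalR (t • p) (zet N j) = t * evalR p (zet N j) := by
  simp only [evalR_eq_pairCP _ (norm_zet N j), pairCP_smul_right]

lemma exists_mul_fst_le_pairCP {n N : ℕ} (hnN : n < N) {c : Coef n} (hc : c ∈ Cplus n N) :
    ∃ ε > 0, ∀ p ∈ Pnn n N, ε * p.1 ≤ pairCP c p := by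
  obtain ⟨p₀, ⟨hp₀, hp₀1⟩, hmin⟩ := (isCompact_Pnn_normalized (n := n) hnN).exists_isMinOn
    ⟨((1 : ℝ), 0), fun j _ => by simp [evalR_one], rfl⟩ (continuous_pairCP c).continuousOn
  refine ⟨pairCP c p₀, hc p₀ hp₀ (fun h => by simp [h] at hp₀1), fun p hp => ?_⟩
  rcases (fst_nonneg_of_mem_Pnn hnN hp).eq_or_lt with h | h
  · rw [← h, mul_zero]
    by_cases hp0 : p = 0
    · simp [hp0, pairCP_zero_right]
    · exact (hc p hp hp0).le
  · have := hmin (show p.1⁻¹ • p ∈ _ from ⟨fun j hj => by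
      rw [evalR_smul]
      exact mul_nonneg (by positivity) (hp j hj), by simp [h.ne']⟩)
    simp only [Set.mem_ofPred_eq, pairCP_smul_right] at this
    rwa [inv_mul_eq_div, le_div_iff₀ h] at this

lemma Pplus_subset_Pnn (n N : ℕ) : Pplus n N ⊆ Pnn n N := fun _ hp j hj => (hp j hj).le

/-- Sublevel sets of `Jlam` stay away from the boundary and from infinity. -/
lemma Jlam_coercive {n N : ℕ} (hnN : n < N) {c : Coef n} (hc : c ∈ Cplus n N)
    (m : Fin n → ℂ) {lam : ℝ} (hlam : 0 < lam) (r : ℝ) :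
    ∃ δ > 0, ∃ b : ℝ, ∀ P Q : Coef n, (P, Q) ∈ DomOp n N → Jlam N c m lam P Q ≤ r →
      ∀ j ∈ idxs N, evalR P (zet N j) ∈ Set.Icc δ (2 * N : ℝ) ∧ evalR Q (zet N j) ∈ Set.Icc δ b := by
  have hN : (0 : ℝ) < 2 * N := by
    have : (0 : ℝ) < N := by exact_mod_cast (by omega : 0 < N)
    linarith
  obtain ⟨ε, hε, hεc⟩ := exists_mul_fst_le_pairCP hnN hc
  obtain ⟨M, hM⟩ := (isCompact_Pnn_normalized (n := n) hnN).bddAbove_image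
    (continuous_pairCP ((0 : ℝ), m)).continuousOn
  obtain ⟨L, hL⟩ := scalar_coercive hε hlam (2 * N)
  obtain ⟨δ, hδ, b, hb⟩ := hL (2 * N * (r + M) + 2 * N * L - L)
  refine ⟨δ, hδ, b, fun P Q ⟨hP, hP1, hQ⟩ hJ j hj => ?_⟩
  dsimp only at hP hP1 hQ
  have hPle : ∀ i ∈ idxs N, evalR P (zet N i) ≤ 2 * N := fun i hi => by
    simpa [hP1] using le_of_mem_Pnn hnN (Pplus_subset_Pnn _ _ hP) hi
  set g : ℤ → ℝ := fun i => ε * evalR Q (zet N i) +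
    evalR P (zet N i) * Real.log (evalR P (zet N i) / evalR Q (zet N i)) -
    lam * Real.log (evalR P (zet N i)) with hg
  have hgL : ∀ i ∈ idxs N, 0 ≤ g i + L := fun i hi => by
    have := (hb _ _ (hP i hi) (hPle i hi) (hQ i hi)).1
    simp only [hg]
    linarith
  have hsum : ∑ i ∈ idxs N, g i ≤ 2 * N * (r + M) := by
    have h1 := hεc Q (Pplus_subset_Pnn _ _ hQ)
    have h2 : pairCP ((0 : ℝ), m) P ≤ M := hM ⟨P, ⟨Pplus_subset_Pnn _ _ hP, hP1⟩, rfl⟩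
    simp only [hg, Finset.sum_sub_distrib, Finset.sum_add_distrib, ← Finset.mul_sum]
    rw [sum_evalR hnN]
    simp only [Jlam, Jfun] at hJ
    set S := ∑ i ∈ idxs N, evalR P (zet N i) *
      Real.log (evalR P (zet N i) / evalR Q (zet N i))
    set T := ∑ i ∈ idxs N, Real.log (evalR P (zet N i))
    have h3 : ε * Q.1 + 1 / (2 * N) * S - lam / (2 * N) * T ≤ r + M := by linarith
    calc ε * (2 * N * Q.1) + S - lam * T
        = 2 * N * (ε * Q.1 + 1 / (2 * N) * S - lam / (2 * N) * T) := by
          have hN0 : (N : ℝ) ≠ 0 := by rintro h; simp [h] at hN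
          field_simp
      _ ≤ _ := by gcongr
  have hgj : g j ≤ 2 * N * (r + M) + 2 * N * L - L := by
    have := Finset.single_le_sum hgL hj
    rw [Finset.sum_add_distrib, Finset.sum_const, nsmul_eq_mul, card_idxs] at this
    linarith
  obtain ⟨h1, h2, h3⟩ := (hb _ _ (hP j hj) (hPle j hj) (hQ j hj)).2 hgj
  exact ⟨⟨h1, hPle j hj⟩, h2, h3⟩

lemma continuousOn_Jlam {n : ℕ} (N : ℕ) (c : Coef n) (m : Fin n → ℂ) (lam : ℝ) :
    ContinuousOn (fun PQ : Coef n × Coef n => Jlam N c m lam PQ.1 PQ.2) (DomOp n N) := by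
  have hev : ∀ z, Continuous fun p : Coef n => evalR p z := continuous_evalR
  have hc := continuous_pairCP c
  have hm := continuous_pairCP ((0 : ℝ), m)
  unfold Jlam Jfun
  refine ContinuousOn.sub (ContinuousOn.add (by fun_prop) (continuousOn_const.mul
    (continuousOn_finsetSum _ fun j hj => ?_))) (continuousOn_const.mul
    (continuousOn_finsetSum _ fun j hj => ?_))
  · have h1 : ContinuousOn (fun PQ : Coef n × Coef n => evalR PQ.1 (zet N j)) (DomOp n N) := by
      fun_prop
    have h2 : ContinuousOn (fun PQ : Coef n × Coef n => evalR PQ.2 (zet N j)) (DomOp n N) := by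
      fun_prop
    exact h1.mul ((h1.div h2 fun x hx => (hx.2.2 j hj).ne').log
      fun x hx => (div_pos (hx.1 j hj) (hx.2.2 j hj)).ne')
  · exact ContinuousOn.log (by fun_prop) fun x hx => (hx.1 j hj).ne'

lemma exists_minimizer {n N : ℕ} (hnN : n < N) {c : Coef n} (hc : c ∈ Cplus n N)
    (m : Fin n → ℂ) {lam : ℝ} (hlam : 0 < lam) :
    ∃ PQ ∈ DomOp n N, ∀ PQ' ∈ DomOp n N,
      Jlam N c m lam PQ.1 PQ.2 ≤ Jlam N c m lam PQ'.1 PQ'.2 := by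
  set e : Coef n × Coef n := (((1 : ℝ), 0), ((1 : ℝ), 0))
  have he : e ∈ DomOp n N :=
    ⟨fun j _ => by simp [e, evalR_one], rfl, fun j _ => by simp [e, evalR_one]⟩
  obtain ⟨δ, hδ, b, hb⟩ := Jlam_coercive hnN hc m hlam (Jlam N c m lam e.1 e.2)
  set K : Set (Coef n × Coef n) :=
    ({p | ∀ j ∈ idxs N, evalR p (zet N j) ∈ Set.Icc δ (2 * N : ℝ)} ∩ Prod.fst ⁻¹' {1}) ×ˢ
      {q | ∀ j ∈ idxs N, evalR q (zet N j) ∈ Set.Icc δ b} with hK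
  have hKc : IsCompact K := ((isCompact_evalR_Icc hnN _ _).inter_right
    (isClosed_singleton.preimage continuous_fst)).prod (isCompact_evalR_Icc hnN _ _)
  have hKD : K ⊆ DomOp n N := fun x hx =>
    ⟨fun j hj => hδ.trans_le (hx.1.1 j hj).1, hx.1.2, fun j hj => hδ.trans_le (hx.2 j hj).1⟩
  have hDK : ∀ x ∈ DomOp n N, Jlam N c m lam x.1 x.2 ≤ Jlam N c m lam e.1 e.2 → x ∈ K :=
    fun x hx hJ => ⟨⟨fun j hj => (hb x.1 x.2 hx hJ j hj).1, hx.2.1⟩,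
      fun j hj => (hb x.1 x.2 hx hJ j hj).2⟩
  have heK := hDK e he le_rfl
  obtain ⟨x, hx, hmin⟩ := hKc.exists_isMinOn ⟨e, heK⟩ ((continuousOn_Jlam N c m lam).mono hKD)
  refine ⟨x, hKD hx, fun y hy => ?_⟩
  by_cases hy' : Jlam N c m lam y.1 y.2 ≤ Jlam N c m lam e.1 e.2
  · exact hmin (hDK y hy hy')
  · exact (hmin heK).trans (not_le.1 hy').le

/-! ### Stationarity conditions -/

lemma eventually_mem_Pplus {n N : ℕ} {p : Coef n} (hp : p ∈ Pplus n N) (h : Coef n) :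
    ∀ᶠ t : ℝ in 𝓝 0, p + t • h ∈ Pplus n N := by
  refine (Finset.eventually_all (idxs N)).2 fun j hj => ?_
  have hcont : Continuous fun t : ℝ => evalR (p + t • h) (zet N j) :=
    (continuous_evalR _).comp (by fun_prop)
  exact hcont.continuousAt.eventually_const_lt (by simpa using hp j hj)

lemma hasDerivAt_pairCP {n : ℕ} (c p h : Coef n) :
    HasDerivAt (fun t : ℝ => pairCP c (p + t • h)) (pairCP c h) 0 := by
  simp only [pairCP_add_smul_right]
  simpa using ((hasDerivAt_id (0 : ℝ)).mul_const (pairCP c h)).const_add (pairCP c p)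

lemma hasDerivAt_Jlam_right {n N : ℕ} (c : Coef n) (m : Fin n → ℂ) (lam : ℝ) {P Q : Coef n}
    (hP : P ∈ Pplus n N) (hQ : Q ∈ Pplus n N) (h : Coef n) :
    HasDerivAt (fun t : ℝ => Jlam N c m lam P (Q + t • h))
      (pairCP (c - momVec n N (phiOf N P Q)) h) 0 := by
  unfold Jlam Jfun
  rw [pairCP_sub_left, momVec_pairCP, sub_eq_add_neg, ← mul_neg, ← Finset.sum_neg_distrib]
  simp only [evalR_add_smul _ _ _ (norm_zet N _)]
  exact (((hasDerivAt_pairCP c Q h).sub_const _).add ((HasDerivAt.fun_sum fun j hj =>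
    hasDerivAt_log_div_right (hP j hj) (hQ j hj) _).const_mul _)).sub_const _

/-- The logarithmic weight whose moments represent the derivative of `Jlam` in `P`. -/
def logWeight {n : ℕ} (N : ℕ) (lam : ℝ) (P Q : Coef n) (j : ℤ) : ℝ :=
  Real.log (phiOf N P Q j) + 1 - lam * (1 / evalR P (zet N j))

lemma hasDerivAt_Jlam_left {n N : ℕ} (c : Coef n) (m : Fin n → ℂ) (lam : ℝ) {P Q : Coef n}
    (hP : P ∈ Pplus n N) (hQ : Q ∈ Pplus n N) (h : Coef n) :
    HasDerivAt (fun t : ℝ => Jlam N c m lam (P + t • h) Q)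
      (pairCP (momVec n N (logWeight N lam P Q) - ((0 : ℝ), m)) h) 0 := by
  unfold Jlam Jfun
  have hw : pairCP (momVec n N (logWeight N lam P Q) - ((0 : ℝ), m)) h =
      -pairCP ((0 : ℝ), m) h + 1 / (2 * (N : ℝ)) * ∑ j ∈ idxs N,
        (Real.log (evalR P (zet N j) / evalR Q (zet N j)) + 1) * evalR h (zet N j) -
      lam / (2 * (N : ℝ)) * ∑ j ∈ idxs N, 1 / evalR P (zet N j) * evalR h (zet N j) := by
    rw [pairCP_sub_left, momVec_pairCP]
    simp only [logWeight, phiOf, sub_mul, Finset.sum_sub_distrib, mul_assoc lam, ← Finset.mul_sum]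
    ring
  rw [hw]
  simp only [evalR_add_smul _ _ _ (norm_zet N _)]
  exact (((hasDerivAt_pairCP ((0 : ℝ), m) P h).const_sub _).add ((HasDerivAt.fun_sum fun j hj =>
    hasDerivAt_mul_log_div (hP j hj) (hQ j hj) _).const_mul _)).sub
    ((HasDerivAt.fun_sum fun j hj => hasDerivAt_log_affine (hP j hj) _).const_mul _)

/-- The regularized functional `J_λ` attains a minimum over
`𝔓°₊(N) × 𝔓₊(N)`, and every minimizer `(P̂,Q̂)` matches the covariance moments of `c`
and the adjusted logarithmic moments `m_k + ε_k`, with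
`ε_k = (λ/(2N)) Σ_j ζ_j^k / P̂(ζ_j)`. -/
theorem regularized_problem
    (n N : ℕ) (hn : 1 ≤ n) (hnN : n < N)
    (c : Coef n) (hc : c ∈ Cplus n N) (m : Fin n → ℂ) (lam : ℝ) (hlam : 0 < lam) :
    (∃ PQ ∈ DomOp n N, ∀ PQ' ∈ DomOp n N,
        Jlam N c m lam PQ.1 PQ.2 ≤ Jlam N c m lam PQ'.1 PQ'.2) ∧
    ∀ Ph Qh : Coef n, (Ph, Qh) ∈ DomOp n N →
      (∀ PQ' ∈ DomOp n N, Jlam N c m lam Ph Qh ≤ Jlam N c m lam PQ'.1 PQ'.2) →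
      MomCond N c (phiOf N Ph Qh) ∧
      ∀ k : Fin n, lmom N (phiOf N Ph Qh) ((k : ℕ) + 1) =
        m k + ((lam : ℂ) / (2 * (N : ℂ))) *
          ∑ j ∈ idxs N, zet N j ^ ((k : ℕ) + 1) / ((evalR Ph (zet N j) : ℝ) : ℂ) := by
  refine ⟨exists_minimizer hnN hc m hlam, fun P Q ⟨hP, hP1, hQ⟩ hmin => ?_⟩
  dsimp only at hP hP1 hQ
  constructor
  · set d := c - momVec n N (phiOf N P Q)
    have hloc : IsLocalMin (fun t : ℝ => Jlam N c m lam P (Q + t • d)) 0 := by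
      filter_upwards [eventually_mem_Pplus hQ d] with t ht
      simpa using hmin (P, Q + t • d) ⟨hP, hP1, ht⟩
    have h0 := pairCP_self_eq_zero
      (hloc.hasDerivAt_eq_zero (hasDerivAt_Jlam_right c m lam hP hQ d))
    rw [sub_eq_zero.1 h0]
    refine ⟨?_, fun k => rfl⟩
    simp [dmom, momVec]
  · intro k
    set v := momVec n N (logWeight N lam P Q) - ((0 : ℝ), m) with hv
    have hloc : IsLocalMin (fun t : ℝ => Jlam N c m lam (P + t • ((0 : ℝ), v.2)) Q) 0 := by
      filter_upwards [eventually_mem_Pplus hP ((0 : ℝ), v.2)] with t ht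
      simpa using hmin (P + t • ((0 : ℝ), v.2), Q) ⟨ht, by simp [hP1], hQ⟩
    have hz : pairCP v ((0 : ℝ), v.2) = 0 :=
      hloc.hasDerivAt_eq_zero (hasDerivAt_Jlam_left c m lam hP hQ ((0 : ℝ), v.2))
    have h0 : (((0 : ℝ), v.2) : Coef n) = 0 := pairCP_self_eq_zero (by
      simpa [pairCP] using hz)
    have hk : v.2 k = 0 := congrFun (congrArg Prod.snd h0) k
    have hdm : dmom N (logWeight N lam P Q) ((k : ℕ) + 1) = m k := by
      simpa [hv, momVec, sub_eq_zero] using hk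
    have hexp : ∀ j, zet N j ^ (((k : ℕ) : ℤ) + 1) = zet N j ^ ((k : ℕ) + 1) := fun j => by
      exact_mod_cast zpow_natCast (zet N j) ((k : ℕ) + 1)
    rw [← hdm]
    simp only [lmom, dmom, logWeight, hexp]
    push_cast
    have hlamSum : ∑ j ∈ idxs N, zet N j ^ ((k : ℕ) + 1) *
        ((lam : ℂ) * (1 / ((evalR P (zet N j) : ℝ) : ℂ))) =
        lam * ∑ j ∈ idxs N, zet N j ^ ((k : ℕ) + 1) / ((evalR P (zet N j) : ℝ) : ℂ) := by
      rw [Finset.mul_sum]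
      exact Finset.sum_congr rfl fun j _ => by ring
    simp only [mul_sub, mul_add, Finset.sum_sub_distrib, Finset.sum_add_distrib, mul_one,
      sum_zet_pow hnN k, hlamSum]
    ring
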